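/- Let X be a nonnegative-integer-valued random variable such that E[X^p] < ∞ for some real p > 0 and such that 0 < P[X ≤ n] < 1 for every n ∈ ℕ. Let Φ denote the standard Gaussian cumulative distribution function and let Q_n be the unique real number with Φ(Q_n) = P[X ≤ n]. Then for every real u with 0 < u < p and every k ∈ ℕ, the series ∑_{n=0}^∞ exp(−Q_n²/(2u)) |Q_n|^k converges. (Lemma C.4: finiteness of the moment-like quantities m^{(k)}(u) under a p-th moment condition, proved via Mill's ratio.) -/

import Mathlib

open MeasureTheory

/-- The standard Gaussian cumulative distribution function. -/
noncomputable def stdGaussianCDF (x : ℝ) : ℝ :=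
  ∫ t in Set.Iic x, (Real.sqrt (2 * Real.pi))⁻¹ * Real.exp (-t^2 / 2)

theorem gaussianTail_lower_bound (q : ℝ) :
    (Real.sqrt (2 * Real.pi))⁻¹ * Real.exp (-(|q| + 1) ^ 2 / 2) ≤ 1 - stdGaussianCDF q := by
  have hf : (fun t : ℝ => (Real.sqrt (2 * Real.pi))⁻¹ * Real.exp (-t ^ 2 / 2)) =
      ProbabilityTheory.gaussianPDFReal 0 1 := by
    funext t
    simp [ProbabilityTheory.gaussianPDFReal]
  have hint := ProbabilityTheory.integrable_gaussianPDFReal 0 1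
  have hone := ProbabilityTheory.integral_gaussianPDFReal_eq_one 0 (v := 1) one_ne_zero
  rw [← hf] at hint hone
  have hsplit := intervalIntegral.integral_Iic_add_Ioi (b := q) hint.integrableOn hint.integrableOn
  rw [hone] at hsplit
  have hsub : Set.Ioc |q| (|q| + 1) ⊆ Set.Ioi q := fun t ht => (le_abs_self q).trans_lt ht.1
  have hmono := setIntegral_mono_set (hint.integrableOn (s := Set.Ioi q))
    (Filter.Eventually.of_forall fun t => by simp only [Pi.zero_apply]; positivity)
    hsub.eventuallyLE
  have hconst : ∫ _ in Set.Ioc |q| (|q| + 1),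
      (Real.sqrt (2 * Real.pi))⁻¹ * Real.exp (-(|q| + 1) ^ 2 / 2) ≤
      ∫ t in Set.Ioc |q| (|q| + 1), (Real.sqrt (2 * Real.pi))⁻¹ * Real.exp (-t ^ 2 / 2) := by
    refine setIntegral_mono_on (integrableOn_const (by simp)) hint.integrableOn measurableSet_Ioc fun t ht => ?_
    have ht0 : 0 ≤ t := (abs_nonneg q).trans ht.1.le
    have ht1 : t ^ 2 ≤ (|q| + 1) ^ 2 := pow_le_pow_left₀ ht0 ht.2 2
    gcongr
  simp only [setIntegral_const, Real.volume_real_Ioc, add_sub_cancel_left, zero_le_one,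
    sup_of_le_left, one_smul] at hconst
  unfold stdGaussianCDF
  linarith

theorem exp_neg_sq_mul_abs_pow_le {u v : ℝ} (hu : 0 < u) (huv : u < v) (k : ℕ) :
    ∃ C : ℝ, 0 ≤ C ∧ ∀ q : ℝ, Real.exp (-q ^ 2 / (2 * u)) * |q| ^ k ≤
      C * Real.exp (-(|q| + 1) ^ 2 / 2) ^ (1 / v) := by
  have hv : 0 < v := hu.trans huv
  obtain ⟨a, ha⟩ : ∃ a, a = 1 / (2 * u) := ⟨_, rfl⟩
  obtain ⟨b, hb⟩ : ∃ b, b = 1 / (2 * v) := ⟨_, rfl⟩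
  have hab : 0 < a - b := by
    rw [ha, hb, sub_pos]
    gcongr
  refine ⟨Real.exp (b + (2 * b + k) ^ 2 / (4 * (a - b))), (Real.exp_pos _).le, fun q => ?_⟩
  rw [← Real.exp_mul, ← Real.exp_add]
  have hpow : |q| ^ k ≤ Real.exp (k * |q|) := by
    rw [Real.exp_nat_mul]
    have := Real.add_one_le_exp |q|
    gcongr
    linarith
  refine (mul_le_mul_of_nonneg_left hpow (Real.exp_pos _).le).trans ?_
  rw [← Real.exp_add, Real.exp_le_exp]
  have h₁ : -q ^ 2 / (2 * u) = -(a * |q| ^ 2) := by rw [ha, sq_abs]; ring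
  have h₂ : -(|q| + 1) ^ 2 / 2 * (1 / v) = -(b * (|q| + 1) ^ 2) := by rw [hb]; field_simp
  have h₃ : (2 * b + k) ^ 2 / (4 * (a - b)) + (a - b) * |q| ^ 2 - (2 * b + k) * |q| =
      (2 * b + k - 2 * (a - b) * |q|) ^ 2 / (4 * (a - b)) := by
    field_simp
    ring
  have h₄ : 0 ≤ (2 * b + k - 2 * (a - b) * |q|) ^ 2 / (4 * (a - b)) := by positivity
  rw [h₁, h₂]
  linarith

theorem tail_le_moment_mul_rpow {Ω : Type*} [MeasurableSpace Ω] (μ : Measure Ω)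
    [IsProbabilityMeasure μ] (X : Ω → ℕ) (hX : Measurable X) {p : ℝ} (hp : 0 < p)
    (hmom : Integrable (fun ω => (X ω : ℝ) ^ p) μ) (n : ℕ) :
    1 - μ.real {ω | X ω ≤ n} ≤ (∫ ω, (X ω : ℝ) ^ p ∂μ) * ((n + 1 : ℕ) : ℝ) ^ (-p) := by
  have hmeas : MeasurableSet {ω | X ω ≤ n} := hX measurableSet_Iic
  rw [← probReal_compl_eq_one_sub hmeas]
  have hmarkov := mul_meas_ge_le_integral_of_nonneg
    (Filter.Eventually.of_forall fun ω => by simp only [Pi.zero_apply]; positivity) hmom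
    (((n + 1 : ℕ) : ℝ) ^ p)
  have hsub : {ω | X ω ≤ n}ᶜ ⊆ {ω | ((n + 1 : ℕ) : ℝ) ^ p ≤ (X ω : ℝ) ^ p} := by
    intro ω hω
    have hω' : n + 1 ≤ X ω := by simpa using hω
    exact Real.rpow_le_rpow (by positivity) (by exact_mod_cast hω') hp.le
  refine (measureReal_mono hsub).trans ?_
  rw [Real.rpow_neg (by positivity), ← div_eq_mul_inv, le_div_iff₀' (by positivity)]
  exact hmarkov

theorem stmt14 {Ω : Type*} [MeasurableSpace Ω] (μ : Measure Ω)
    [IsProbabilityMeasure μ] (X : Ω → ℕ) (hX : Measurable X)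
    (p : ℝ) (hp : 0 < p)
    (hmom : Integrable (fun ω => (X ω : ℝ) ^ p) μ)
    (hcdf : ∀ n : ℕ, 0 < (μ {ω | X ω ≤ n}).toReal ∧ (μ {ω | X ω ≤ n}).toReal < 1)
    (Q : ℕ → ℝ) (hQ : ∀ n, stdGaussianCDF (Q n) = (μ {ω | X ω ≤ n}).toReal) :
    ∀ u : ℝ, 0 < u → u < p → ∀ k : ℕ,
      Summable fun n : ℕ => Real.exp (-(Q n)^2 / (2*u)) * |Q n| ^ k := by
  intro u hu hup k
  obtain ⟨v, huv, hvp⟩ := exists_between hup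
  have hv : 0 < v := hu.trans huv
  obtain ⟨C, hC, hbound⟩ := exp_neg_sq_mul_abs_pow_le hu huv k
  set M : ℝ := ∫ ω, (X ω : ℝ) ^ p ∂μ with hM
  have hM0 : 0 ≤ M := integral_nonneg fun ω => by positivity
  have hsum : Summable fun n : ℕ =>
      C * (Real.sqrt (2 * Real.pi) * M) ^ (1 / v) * ((n + 1 : ℕ) : ℝ) ^ (-(p / v)) := by
    refine Summable.mul_left _ ((summable_nat_add_iff 1).2 (Real.summable_nat_rpow.2 ?_))
    rw [neg_lt_neg_iff, one_lt_div hv]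
    exact hvp
  refine hsum.of_nonneg_of_le (fun n => by positivity) fun n => (hbound (Q n)).trans ?_
  have htail := (gaussianTail_lower_bound (Q n)).trans
    ((congrArg (1 - ·) (hQ n)).le.trans (tail_le_moment_mul_rpow μ X hX hp hmom n))
  rw [inv_mul_le_iff₀ (by positivity), ← mul_assoc, ← hM] at htail
  have hroot := Real.rpow_le_rpow (Real.exp_pos _).le htail (one_div_nonneg.2 hv.le)
  rw [Real.mul_rpow (by positivity) (by positivity), ← Real.rpow_mul (by positivity),
    show -p * (1 / v) = -(p / v) by ring] at hroot
  rw [mul_assoc]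
  exact mul_le_mul_of_nonneg_left hroot hC
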